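/- arXiv:1810.02473 — 3 statements merged into one kernel-verified Lean document; each statement's English description precedes it below -/
import Mathlib

section
/- A bicubic polynomial is uniquely determined by its 16 Hermite degrees of freedom: if p is a real polynomial in two variables of degree at most 3 in each variable separately, and for every vertex v ∈ {-1,1}² one has p(v) = 0, ∂ₓp(v) = 0, ∂_yp(v) = 0, and ∂ₓ∂_yp(v) = 0, then p = 0. -/
/-- The cubic polynomial function with coefficients `c`. -/
def cubicEval (c : Fin 4 → ℝ) (t : ℝ) : ℝ := ∑ i : Fin 4, c i * t ^ (i : ℕ)

/-- The derivative of the cubic polynomial function with coefficients `c`. -/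
def cubicDeriv (c : Fin 4 → ℝ) (t : ℝ) : ℝ :=
  ∑ i : Fin 4, c i * ((i : ℕ) * t ^ ((i : ℕ) - 1))

theorem hasDerivAt_cubicEval (c : Fin 4 → ℝ) (t : ℝ) :
    HasDerivAt (cubicEval c) (cubicDeriv c t) t :=
  HasDerivAt.fun_sum fun i _ => (hasDerivAt_pow (i : ℕ) t).const_mul (c i)

/-- A univariate cubic is determined by its values and derivatives at `-1` and `1`. -/
theorem eq_zero_of_cubic_hermite (c : Fin 4 → ℝ)
    (h : ∀ t ∈ ({-1, 1} : Set ℝ), cubicEval c t = 0 ∧ cubicDeriv c t = 0) : c = 0 := by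
  obtain ⟨h₁, h₂⟩ := h (-1) (by simp)
  obtain ⟨h₃, h₄⟩ := h 1 (by simp)
  simp only [cubicEval, cubicDeriv, Fin.sum_univ_four] at h₁ h₂ h₃ h₄
  norm_num at h₁ h₂ h₃ h₄
  ext i
  fin_cases i <;> simp <;> linarith

/-- Differentiating a family of cubics in `y` under the outer cubic in `x`. -/
theorem hasDerivAt_cubicEval_cubicEval (a : Fin 4 → Fin 4 → ℝ) (x y : ℝ) :
    HasDerivAt (fun t => cubicEval (fun i => cubicEval (a i) t) x)
      (cubicEval (fun i => cubicDeriv (a i) y) x) y :=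
  HasDerivAt.fun_sum fun i _ => (hasDerivAt_cubicEval (a i) y).mul_const (x ^ (i : ℕ))


/-- A bicubic polynomial: a real function on ℝ² that is polynomial of degree at
most 3 in each variable separately. -/
def Bicubic (p : ℝ → ℝ → ℝ) : Prop :=
  ∃ a : Fin 4 → Fin 4 → ℝ,
    ∀ x y : ℝ, p x y = ∑ i : Fin 4, ∑ j : Fin 4, a i j * x ^ (i : ℕ) * y ^ (j : ℕ)

/-- Partial derivative in the first (x) variable. -/
noncomputable def pdx (p : ℝ → ℝ → ℝ) (x y : ℝ) : ℝ := deriv (fun t => p t y) x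

/-- Partial derivative in the second (y) variable. -/
noncomputable def pdy (p : ℝ → ℝ → ℝ) (x y : ℝ) : ℝ := deriv (fun t => p x t) y

/-- A bicubic polynomial is uniquely determined by its 16 Hermite
degrees of freedom: if the value, both first partials and the mixed second
partial vanish at all four vertices of [-1,1]², the polynomial is zero. -/
theorem bicubic_hermite_unisolvence (p : ℝ → ℝ → ℝ) (hp : Bicubic p)
    (h : ∀ x ∈ ({-1, 1} : Set ℝ), ∀ y ∈ ({-1, 1} : Set ℝ),
      p x y = 0 ∧ pdx p x y = 0 ∧ pdy p x y = 0 ∧ pdx (pdy p) x y = 0) :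
    ∀ x y : ℝ, p x y = 0 := by
  obtain ⟨a, ha⟩ := hp
  have hp : p = fun x y => cubicEval (fun i => cubicEval (a i) y) x := by
    ext x y
    simp only [ha, cubicEval, Finset.sum_mul]
    exact Finset.sum_congr rfl fun i _ => Finset.sum_congr rfl fun j _ => by ring
  have hy : pdy p = fun x y => cubicEval (fun i => cubicDeriv (a i) y) x := by
    ext x y
    rw [hp]
    exact (hasDerivAt_cubicEval_cubicEval a x y).deriv
  have hval : ∀ y ∈ ({-1, 1} : Set ℝ), (fun i => cubicEval (a i) y) = 0 := by
    intro y hy'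
    refine eq_zero_of_cubic_hermite _ fun x hx => ?_
    obtain ⟨h₁, h₂, -, -⟩ := h x hx y hy'
    rw [hp] at h₁ h₂
    exact ⟨h₁, (hasDerivAt_cubicEval _ x).deriv.symm.trans h₂⟩
  have hder : ∀ y ∈ ({-1, 1} : Set ℝ), (fun i => cubicDeriv (a i) y) = 0 := by
    intro y hy'
    refine eq_zero_of_cubic_hermite _ fun x hx => ?_
    obtain ⟨-, -, h₁, h₂⟩ := h x hx y hy'
    rw [hy] at h₁ h₂
    exact ⟨h₁, (hasDerivAt_cubicEval _ x).deriv.symm.trans h₂⟩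
  have hzero : ∀ i, a i = 0 := fun i =>
    eq_zero_of_cubic_hermite _ fun y hy' =>
      ⟨congrFun (hval y hy') i, congrFun (hder y hy') i⟩
  intro x y
  simp [ha, hzero]
end

section
/- A tricubic polynomial is uniquely determined by its 64 Hermite degrees of freedom: if p is a real polynomial in three variables of degree at most 3 in each variable separately, and at every vertex v ∈ {-1,1}³ all eight partial derivatives ∂ₓ^κ₁∂_y^κ₂∂_z^κ₃ p(v) with κ₁,κ₂,κ₃ ∈ {0,1} vanish, then p = 0. -/
/-- A tricubic polynomial: a real function on ℝ³ that is polynomial of degree at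
most 3 in each variable separately. -/
def Tricubic (p : ℝ → ℝ → ℝ → ℝ) : Prop :=
  ∃ a : Fin 4 → Fin 4 → Fin 4 → ℝ,
    ∀ x y z : ℝ, p x y z =
      ∑ i : Fin 4, ∑ j : Fin 4, ∑ k : Fin 4,
        a i j k * x ^ (i : ℕ) * y ^ (j : ℕ) * z ^ (k : ℕ)

/-- Partial derivative in the first (x) variable. -/
noncomputable def pdx3 (p : ℝ → ℝ → ℝ → ℝ) (x y z : ℝ) : ℝ := deriv (fun t => p t y z) x

/-- Partial derivative in the second (y) variable. -/
noncomputable def pdy3 (p : ℝ → ℝ → ℝ → ℝ) (x y z : ℝ) : ℝ := deriv (fun t => p x t z) y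

/-- Partial derivative in the third (z) variable. -/
noncomputable def pdz3 (p : ℝ → ℝ → ℝ → ℝ) (x y z : ℝ) : ℝ := deriv (fun t => p x y t) z

/-- A real function that is polynomial of degree at most 3. -/
def IsCubic (f : ℝ → ℝ) : Prop :=
  ∃ c : Fin 4 → ℝ, ∀ t, f t = ∑ i : Fin 4, c i * t ^ (i : ℕ)

/-- The coefficients of the derivative of a cubic polynomial. -/
def cubicDerivCoeff (c : Fin 4 → ℝ) : Fin 4 → ℝ := ![c 1, 2 * c 2, 3 * c 3, 0]

theorem hasDerivAt_cubic (c : Fin 4 → ℝ) (t : ℝ) :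
    HasDerivAt (fun s => ∑ i : Fin 4, c i * s ^ (i : ℕ))
      (∑ i : Fin 4, cubicDerivCoeff c i * t ^ (i : ℕ)) t := by
  refine (HasDerivAt.fun_sum (u := Finset.univ) fun (i : Fin 4) _ =>
    (hasDerivAt_pow (i : ℕ) t).const_mul (c i)).congr_deriv ?_
  simp [Fin.sum_univ_four, cubicDerivCoeff]
  ring

/-- Unisolvence of one-dimensional cubic Hermite interpolation. -/
theorem IsCubic.eq_zero {f : ℝ → ℝ} (hf : IsCubic f)
    (h : ∀ t ∈ ({-1, 1} : Set ℝ), f t = 0 ∧ deriv f t = 0) (t : ℝ) : f t = 0 := by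
  obtain ⟨c, hc⟩ := hf
  obtain rfl : f = fun t => ∑ i : Fin 4, c i * t ^ (i : ℕ) := funext hc
  obtain ⟨hm, hm'⟩ := h (-1) (by simp)
  obtain ⟨hp, hp'⟩ := h 1 (by simp)
  rw [(hasDerivAt_cubic c _).deriv] at hm' hp'
  simp [Fin.sum_univ_four, cubicDerivCoeff] at hm hm' hp hp'
  have h0 : c 0 = 0 := by linarith
  have h1 : c 1 = 0 := by linarith
  have h2 : c 2 = 0 := by linarith
  have h3 : c 3 = 0 := by linarith
  simp [Fin.sum_univ_four, h0, h1, h2, h3]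

namespace Tricubic

variable {p : ℝ → ℝ → ℝ → ℝ}

theorem isCubic_x (hp : Tricubic p) (y z : ℝ) : IsCubic fun t => p t y z := by
  obtain ⟨a, ha⟩ := hp
  refine ⟨fun i => ∑ j : Fin 4, ∑ k : Fin 4, a i j k * y ^ (j : ℕ) * z ^ (k : ℕ), fun t => ?_⟩
  simp only [ha, Finset.sum_mul]
  refine Finset.sum_congr rfl fun i _ => Finset.sum_congr rfl fun j _ =>
    Finset.sum_congr rfl fun k _ => by ring

/-- Exchanging the first two variables. -/
theorem swap_xy (hp : Tricubic p) : Tricubic fun x y z => p y x z := by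
  obtain ⟨a, ha⟩ := hp
  refine ⟨fun i j k => a j i k, fun x y z => ?_⟩
  simp only [ha]
  rw [Finset.sum_comm]
  refine Finset.sum_congr rfl fun i _ => Finset.sum_congr rfl fun j _ =>
    Finset.sum_congr rfl fun k _ => by ring

/-- Exchanging the first and the last variable. -/
theorem swap_xz (hp : Tricubic p) : Tricubic fun x y z => p z y x := by
  obtain ⟨a, ha⟩ := hp
  refine ⟨fun i j k => a k j i, fun x y z => ?_⟩
  simp only [ha]
  rw [Finset.sum_congr rfl fun _ _ => Finset.sum_comm, Finset.sum_comm,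
    Finset.sum_congr rfl fun _ _ => Finset.sum_comm]
  refine Finset.sum_congr rfl fun i _ => Finset.sum_congr rfl fun j _ =>
    Finset.sum_congr rfl fun k _ => by ring

theorem isCubic_y (hp : Tricubic p) (x z : ℝ) : IsCubic fun t => p x t z :=
  hp.swap_xy.isCubic_x x z

theorem isCubic_z (hp : Tricubic p) (x y : ℝ) : IsCubic fun t => p x y t :=
  hp.swap_xz.isCubic_x y x

theorem pdx (hp : Tricubic p) : Tricubic (pdx3 p) := by
  obtain ⟨a, ha⟩ := hp
  refine ⟨fun i j k => cubicDerivCoeff (fun i => a i j k) i, fun x y z => ?_⟩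
  have h : (fun t => p t y z) = fun t => ∑ j : Fin 4, ∑ k : Fin 4,
      (∑ i : Fin 4, a i j k * t ^ (i : ℕ)) * (y ^ (j : ℕ) * z ^ (k : ℕ)) := by
    funext t
    rw [ha, Finset.sum_comm]
    refine Finset.sum_congr rfl fun j _ => ?_
    rw [Finset.sum_comm]
    refine Finset.sum_congr rfl fun k _ => ?_
    rw [Finset.sum_mul]
    exact Finset.sum_congr rfl fun i _ => by ring
  rw [pdx3, h, (HasDerivAt.fun_sum fun j _ => HasDerivAt.fun_sum fun k _ =>
    (hasDerivAt_cubic (fun i => a i j k) x).mul_const _).deriv]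
  symm
  rw [Finset.sum_comm]
  refine Finset.sum_congr rfl fun j _ => ?_
  rw [Finset.sum_comm]
  refine Finset.sum_congr rfl fun k _ => ?_
  rw [Finset.sum_mul]
  exact Finset.sum_congr rfl fun i _ => by ring

theorem pdy (hp : Tricubic p) : Tricubic (pdy3 p) :=
  hp.swap_xy.pdx.swap_xy

theorem pdz (hp : Tricubic p) : Tricubic (pdz3 p) :=
  hp.swap_xz.pdx.swap_xz

end Tricubic

/-- A tricubic polynomial is uniquely determined by its 64 Hermite
degrees of freedom: if all eight partial derivatives ∂ₓ^κ₁∂_y^κ₂∂_z^κ₃ p with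
κᵢ ∈ {0,1} vanish at all eight vertices of [-1,1]³, the polynomial is zero. -/
theorem tricubic_hermite_unisolvence (p : ℝ → ℝ → ℝ → ℝ) (hp : Tricubic p)
    (h : ∀ x ∈ ({-1, 1} : Set ℝ), ∀ y ∈ ({-1, 1} : Set ℝ), ∀ z ∈ ({-1, 1} : Set ℝ),
      p x y z = 0 ∧
      pdx3 p x y z = 0 ∧ pdy3 p x y z = 0 ∧ pdz3 p x y z = 0 ∧
      pdx3 (pdy3 p) x y z = 0 ∧ pdx3 (pdz3 p) x y z = 0 ∧ pdy3 (pdz3 p) x y z = 0 ∧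
      pdx3 (pdy3 (pdz3 p)) x y z = 0) :
    ∀ x y z : ℝ, p x y z = 0 := by
  have hpy := hp.pdy
  have hpz := hp.pdz
  have hpyz := hp.pdz.pdy
  intro x y z
  refine (hp.isCubic_z x y).eq_zero (fun z hz => ⟨?_, ?_⟩) z
  · refine (hp.isCubic_y x z).eq_zero (fun y hy => ⟨?_, ?_⟩) y
    · exact (hp.isCubic_x y z).eq_zero (fun x hx => ⟨(h x hx y hy z hz).1,
        (h x hx y hy z hz).2.1⟩) x
    · exact (hpy.isCubic_x y z).eq_zero (fun x hx => ⟨(h x hx y hy z hz).2.2.1,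
        (h x hx y hy z hz).2.2.2.2.1⟩) x
  · refine (hpz.isCubic_y x z).eq_zero (fun y hy => ⟨?_, ?_⟩) y
    · exact (hpz.isCubic_x y z).eq_zero (fun x hx => ⟨(h x hx y hy z hz).2.2.2.1,
        (h x hx y hy z hz).2.2.2.2.2.1⟩) x
    · exact (hpyz.isCubic_x y z).eq_zero (fun x hx => ⟨(h x hx y hy z hz).2.2.2.2.2.2.1,
        (h x hx y hy z hz).2.2.2.2.2.2.2⟩) x
end

section
/- Hermite-type mappings with matching vertex data glue to a globally C¹ mapping on a regular vertex patch: let P = [-2,2]² and let the nine patch vertices be the points of {-2,0,2}². Suppose given data α, β, γ : {-2,0,2}² → ℝ² (positions and two derivative vectors per vertex). For each (s,t) ∈ {-1,1}², let Φ_{s,t} : ℝ² → ℝ² be the unique componentwise bicubic polynomial whose Hermite degrees of freedom at each local vertex (x̂,ŷ) ∈ {-1,1}² are: value α(s+x̂, t+ŷ), x-derivative β(s+x̂, t+ŷ), y-derivative γ(s+x̂, t+ŷ), and mixed xy-derivative 0. Define Φ : P → ℝ² by Φ(x,y) = Φ_{s,t}(x-s, y-t) whenever (x,y) lies in the square [s-1,s+1]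 × [t-1,t+1]. Then Φ is well defined (the four pieces agree on all overlaps) and Φ is continuously differentiable on P. -/
/-- Componentwise bicubic ℝ²-valued map. -/
def BicubicV (p : ℝ → ℝ → ℝ × ℝ) : Prop :=
  Bicubic (fun x y => (p x y).1) ∧ Bicubic (fun x y => (p x y).2)

/-- Partial derivative in the first (x) variable (vector valued). -/
noncomputable def pdxV (p : ℝ → ℝ → ℝ × ℝ) (x y : ℝ) : ℝ × ℝ := deriv (fun t => p t y) x

/-- Partial derivative in the second (y) variable (vector valued). -/
noncomputable def pdyV (p : ℝ → ℝ → ℝ × ℝ) (x y : ℝ) : ℝ × ℝ := deriv (fun t => p x t) y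

open Finset

/-- The squared positive part, a `C¹` quadratic spline with a knot at `0`. -/
noncomputable def sqPos (z : ℝ) : ℝ := max z 0 ^ 2

theorem sqPos_of_nonneg {z : ℝ} (hz : 0 ≤ z) : sqPos z = z ^ 2 := by
  rw [sqPos, max_eq_left hz]

theorem sqPos_of_nonpos {z : ℝ} (hz : z ≤ 0) : sqPos z = 0 := by
  rw [sqPos, max_eq_right hz, zero_pow two_ne_zero]

theorem hasDerivAt_sqPos (z : ℝ) : HasDerivAt sqPos (2 * max z 0) z := by
  have hsq : HasDerivAt (fun w : ℝ => w ^ 2) (2 * z) z := by simpa using hasDerivAt_pow 2 z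
  rcases lt_trichotomy z 0 with hz | rfl | hz
  · rw [max_eq_right hz.le, mul_zero]
    refine (hasDerivAt_const z (0 : ℝ)).congr_of_eventuallyEq ?_
    filter_upwards [eventually_le_nhds hz] with w hw using sqPos_of_nonpos hw
  · rw [max_self]
    have hl : HasDerivWithinAt sqPos (2 * 0) (Set.Iic 0) 0 := by
      rw [mul_zero]
      exact (hasDerivWithinAt_const (0 : ℝ) (Set.Iic 0) (0 : ℝ)).congr
        (fun w hw => sqPos_of_nonpos hw) (sqPos_of_nonpos le_rfl)
    have hr : HasDerivWithinAt sqPos (2 * 0) (Set.Ici 0) 0 :=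
      hsq.hasDerivWithinAt.congr (fun w hw => sqPos_of_nonneg hw) (sqPos_of_nonneg le_rfl)
    simpa [Set.Iic_union_Ici] using hl.union hr
  · rw [max_eq_left hz.le]
    refine hsq.congr_of_eventuallyEq ?_
    filter_upwards [eventually_ge_nhds hz] with w hw using sqPos_of_nonneg hw

theorem contDiff_sqPos : ContDiff ℝ 1 sqPos := by
  rw [contDiff_one_iff_deriv]
  refine ⟨fun z => (hasDerivAt_sqPos z).differentiableAt, ?_⟩
  rw [show deriv sqPos = fun z => 2 * max z 0 from funext fun z => (hasDerivAt_sqPos z).deriv]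
  fun_prop

/-- The cubic Hermite spline on the knots `-2, 0, 2` with value `1` and slope `0` at `0`,
vanishing outside `[-2, 2]`. -/
noncomputable def valueSpline (z : ℝ) : ℝ :=
  ((1 - z) * sqPos (z + 2) + 2 * z * sqPos z - (1 + z) * sqPos (z - 2)) / 4

/-- The cubic Hermite spline on the knots `-2, 0, 2` with value `0` and slope `1` at `0`,
vanishing outside `[-2, 2]`. -/
noncomputable def slopeSpline (z : ℝ) : ℝ :=
  (z * sqPos (z + 2) - 8 * sqPos z - z * sqPos (z - 2)) / 4

theorem contDiff_valueSpline : ContDiff ℝ 1 valueSpline := by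
  have := contDiff_sqPos
  unfold valueSpline
  fun_prop

theorem contDiff_slopeSpline : ContDiff ℝ 1 slopeSpline := by
  have := contDiff_sqPos
  unfold slopeSpline
  fun_prop

theorem valueSpline_of_two_le_abs {z : ℝ} (hz : 2 ≤ |z|) : valueSpline z = 0 := by
  rcases le_abs'.1 hz with h | h
  · rw [valueSpline, sqPos_of_nonpos (by linarith), sqPos_of_nonpos (by linarith),
      sqPos_of_nonpos (by linarith)]
    ring
  · rw [valueSpline, sqPos_of_nonneg (by linarith), sqPos_of_nonneg (by linarith),
      sqPos_of_nonneg (by linarith)]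
    ring

theorem slopeSpline_of_two_le_abs {z : ℝ} (hz : 2 ≤ |z|) : slopeSpline z = 0 := by
  rcases le_abs'.1 hz with h | h
  · rw [slopeSpline, sqPos_of_nonpos (by linarith), sqPos_of_nonpos (by linarith),
      sqPos_of_nonpos (by linarith)]
    ring
  · rw [slopeSpline, sqPos_of_nonneg (by linarith), sqPos_of_nonneg (by linarith),
      sqPos_of_nonneg (by linarith)]
    ring

theorem valueSpline_add_one {u : ℝ} (hu : u ∈ Set.Icc (-1 : ℝ) 1) :
    valueSpline (u + 1) = (u - 1) ^ 2 * (u + 2) / 4 := by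
  obtain ⟨h₁, h₂⟩ := hu
  rw [valueSpline, sqPos_of_nonneg (by linarith), sqPos_of_nonneg (by linarith),
    sqPos_of_nonpos (by linarith)]
  ring

theorem valueSpline_sub_one {u : ℝ} (hu : u ∈ Set.Icc (-1 : ℝ) 1) :
    valueSpline (u - 1) = (u + 1) ^ 2 * (2 - u) / 4 := by
  obtain ⟨h₁, h₂⟩ := hu
  rw [valueSpline, sqPos_of_nonneg (by linarith), sqPos_of_nonpos (by linarith),
    sqPos_of_nonpos (by linarith)]
  ring

theorem slopeSpline_add_one {u : ℝ} (hu : u ∈ Set.Icc (-1 : ℝ) 1) :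
    slopeSpline (u + 1) = (u - 1) ^ 2 * (u + 1) / 4 := by
  obtain ⟨h₁, h₂⟩ := hu
  rw [slopeSpline, sqPos_of_nonneg (by linarith), sqPos_of_nonneg (by linarith),
    sqPos_of_nonpos (by linarith)]
  ring

theorem slopeSpline_sub_one {u : ℝ} (hu : u ∈ Set.Icc (-1 : ℝ) 1) :
    slopeSpline (u - 1) = (u + 1) ^ 2 * (u - 1) / 4 := by
  obtain ⟨h₁, h₂⟩ := hu
  rw [slopeSpline, sqPos_of_nonneg (by linarith), sqPos_of_nonpos (by linarith),
    sqPos_of_nonpos (by linarith)]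
  ring

/-- On a cell `[s - 1, s + 1]` only the two endpoint splines contribute. -/
theorem sum_knots_smul_eq {E : Type*} [AddCommGroup E] [Module ℝ E] {h : ℝ → ℝ}
    (hh : ∀ z, 2 ≤ |z| → h z = 0) {s : ℝ} (hs : s ∈ ({-1, 1} : Set ℝ)) {x : ℝ}
    (hx : x ∈ Set.Icc (s - 1) (s + 1)) (F : ℝ → E) :
    ∑ v ∈ ({-2, 0, 2} : Finset ℝ), h (x - v) • F v =
      h (x - s + 1) • F (s + -1) + h (x - s - 1) • F (s + 1) := by
  obtain ⟨h₁, h₂⟩ := hx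
  rw [sum_insert (by norm_num), sum_insert (by norm_num), sum_singleton]
  rcases hs with rfl | rfl
  · rw [hh (x - 2) (le_abs'.2 (Or.inl (by linarith))), zero_smul, add_zero]
    norm_num
    norm_num [sub_eq_add_neg, add_assoc]
  · rw [hh (x - -2) (le_abs'.2 (Or.inr (by linarith))), zero_smul, zero_add]
    norm_num
    norm_num [sub_eq_add_neg, add_assoc]

theorem BicubicV.exists_coeff {p : ℝ → ℝ → ℝ × ℝ} (hp : BicubicV p) :
    ∃ a : Fin 4 → Fin 4 → ℝ × ℝ,
      p = fun x y => ∑ i : Fin 4, ∑ j : Fin 4, (x ^ (i : ℕ) * y ^ (j : ℕ)) • a i j := by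
  obtain ⟨⟨a, ha⟩, ⟨b, hb⟩⟩ := hp
  refine ⟨fun i j => (a i j, b i j), ?_⟩
  funext x y
  apply Prod.ext
  · simp only [ha, Prod.fst_sum, Prod.smul_fst, smul_eq_mul]
    exact sum_congr rfl fun i _ => sum_congr rfl fun j _ => by ring
  · simp only [hb, Prod.snd_sum, Prod.smul_snd, smul_eq_mul]
    exact sum_congr rfl fun i _ => sum_congr rfl fun j _ => by ring

theorem pdxV_sum_smul (f g : Fin 4 → ℝ → ℝ) (a : Fin 4 → Fin 4 → ℝ × ℝ)
    (f' : Fin 4 → ℝ → ℝ) (hf : ∀ i x, HasDerivAt (f i) (f' i x) x) :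
    pdxV (fun x y => ∑ i, ∑ j, (f i x * g j y) • a i j) =
      fun x y => ∑ i, ∑ j, (f' i x * g j y) • a i j := by
  funext x y
  exact (HasDerivAt.fun_sum fun i _ => HasDerivAt.fun_sum fun j _ =>
    ((hf i x).mul_const (g j y)).smul_const (a i j)).deriv

theorem pdyV_sum_smul (f g : Fin 4 → ℝ → ℝ) (a : Fin 4 → Fin 4 → ℝ × ℝ)
    (g' : Fin 4 → ℝ → ℝ) (hg : ∀ j y, HasDerivAt (g j) (g' j y) y) :
    pdyV (fun x y => ∑ i, ∑ j, (f i x * g j y) • a i j) =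
      fun x y => ∑ i, ∑ j, (f i x * g' j y) • a i j := by
  funext x y
  exact (HasDerivAt.fun_sum fun i _ => HasDerivAt.fun_sum fun j _ =>
    ((hg j y).const_mul (f i x)).smul_const (a i j)).deriv

/-- Two-point Hermite interpolation reproduces the monomials of degree at most `3`. -/
theorem pow_eq_hermite {u : ℝ} (hu : u ∈ Set.Icc (-1 : ℝ) 1) (i : Fin 4) :
    u ^ (i : ℕ) =
      valueSpline (u + 1) * (-1) ^ (i : ℕ) + valueSpline (u - 1) * 1 ^ (i : ℕ) +
      slopeSpline (u + 1) * ((i : ℕ) * (-1) ^ ((i : ℕ) - 1)) +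
      slopeSpline (u - 1) * ((i : ℕ) * 1 ^ ((i : ℕ) - 1)) := by
  rw [valueSpline_add_one hu, valueSpline_sub_one hu, slopeSpline_add_one hu,
    slopeSpline_sub_one hu]
  fin_cases i <;> norm_num <;> ring

/-- Bicubic Hermite interpolation with vanishing mixed derivatives at the vertices. -/
theorem BicubicV.eq_hermite {p : ℝ → ℝ → ℝ × ℝ} (hp : BicubicV p)
    (hmix : ∀ x ∈ ({-1, 1} : Set ℝ), ∀ y ∈ ({-1, 1} : Set ℝ), pdxV (pdyV p) x y = 0)
    {u w : ℝ} (hu : u ∈ Set.Icc (-1 : ℝ) 1) (hw : w ∈ Set.Icc (-1 : ℝ) 1) :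
    p u w =
      (valueSpline (u + 1) • (valueSpline (w + 1) • p (-1) (-1) + valueSpline (w - 1) • p (-1) 1) +
       valueSpline (u - 1) • (valueSpline (w + 1) • p 1 (-1) + valueSpline (w - 1) • p 1 1)) +
      (slopeSpline (u + 1) •
        (valueSpline (w + 1) • pdxV p (-1) (-1) + valueSpline (w - 1) • pdxV p (-1) 1) +
       slopeSpline (u - 1) •
        (valueSpline (w + 1) • pdxV p 1 (-1) + valueSpline (w - 1) • pdxV p 1 1)) +
      (valueSpline (u + 1) •
        (slopeSpline (w + 1) • pdyV p (-1) (-1) + slopeSpline (w - 1) • pdyV p (-1) 1) +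
       valueSpline (u - 1) •
        (slopeSpline (w + 1) • pdyV p 1 (-1) + slopeSpline (w - 1) • pdyV p 1 1)) := by
  obtain ⟨a, rfl⟩ := hp.exists_coeff
  have hpow : ∀ (i : Fin 4) (x : ℝ),
      HasDerivAt (fun x : ℝ => x ^ (i : ℕ)) ((i : ℕ) * x ^ ((i : ℕ) - 1)) x :=
    fun i x => hasDerivAt_pow _ x
  have hdx := pdxV_sum_smul (fun i x => x ^ (i : ℕ)) (fun j y => y ^ (j : ℕ)) a _ hpow
  have hdy := pdyV_sum_smul (fun i x => x ^ (i : ℕ)) (fun j y => y ^ (j : ℕ)) a _ hpow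
  have hdxy := pdxV_sum_smul (fun i x => x ^ (i : ℕ))
    (fun j y => (j : ℕ) * y ^ ((j : ℕ) - 1)) a _ hpow
  have hm₁ := hmix (-1) (by simp) (-1) (by simp)
  have hm₂ := hmix (-1) (by simp) 1 (by simp)
  have hm₃ := hmix 1 (by simp) (-1) (by simp)
  have hm₄ := hmix 1 (by simp) 1 (by simp)
  rw [hdy, hdxy] at hm₁ hm₂ hm₃ hm₄
  rw [hdx, hdy]
  have key := congrArg₂ (· + ·)
    (congrArg₂ (· + ·)
      (congrArg (fun e => (slopeSpline (u + 1) * slopeSpline (w + 1)) • e) hm₁)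
      (congrArg (fun e => (slopeSpline (u + 1) * slopeSpline (w - 1)) • e) hm₂))
    (congrArg₂ (· + ·)
      (congrArg (fun e => (slopeSpline (u - 1) * slopeSpline (w + 1)) • e) hm₃)
      (congrArg (fun e => (slopeSpline (u - 1) * slopeSpline (w - 1)) • e) hm₄))
  simp only [smul_zero, add_zero] at key
  rw [← sub_eq_zero, ← key, ← sub_eq_zero]
  simp only [pow_eq_hermite hu, pow_eq_hermite hw]
  simp only [smul_sum, ← sum_add_distrib, ← sum_sub_distrib]
  refine sum_eq_zero fun i _ => sum_eq_zero fun j _ => ?_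
  module

/-- Hermite-type mappings with matching vertex data on the patch
P = [-2,2]², with vertex data α, β, γ given at the nine points of {-2,0,2}² and
vanishing mixed derivative dofs, glue to a well-defined, globally C¹ mapping. -/
theorem hermite_patch_glues_C1 (α β γ : ℝ → ℝ → ℝ × ℝ)
    (Φp : ℝ → ℝ → ℝ → ℝ → ℝ × ℝ)
    (hbic : ∀ s ∈ ({-1, 1} : Set ℝ), ∀ t ∈ ({-1, 1} : Set ℝ), BicubicV (Φp s t))
    (hdof : ∀ s ∈ ({-1, 1} : Set ℝ), ∀ t ∈ ({-1, 1} : Set ℝ),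
      ∀ x' ∈ ({-1, 1} : Set ℝ), ∀ y' ∈ ({-1, 1} : Set ℝ),
        Φp s t x' y' = α (s + x') (t + y') ∧
        pdxV (Φp s t) x' y' = β (s + x') (t + y') ∧
        pdyV (Φp s t) x' y' = γ (s + x') (t + y') ∧
        pdxV (pdyV (Φp s t)) x' y' = 0) :
    (∀ s ∈ ({-1, 1} : Set ℝ), ∀ t ∈ ({-1, 1} : Set ℝ),
     ∀ s' ∈ ({-1, 1} : Set ℝ), ∀ t' ∈ ({-1, 1} : Set ℝ),
      ∀ x y : ℝ, x ∈ Set.Icc (s - 1) (s + 1) → y ∈ Set.Icc (t - 1) (t + 1) →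
        x ∈ Set.Icc (s' - 1) (s' + 1) → y ∈ Set.Icc (t' - 1) (t' + 1) →
        Φp s t (x - s) (y - t) = Φp s' t' (x - s') (y - t')) ∧
    ∃ Φ : ℝ × ℝ → ℝ × ℝ,
      (∀ s ∈ ({-1, 1} : Set ℝ), ∀ t ∈ ({-1, 1} : Set ℝ), ∀ x y : ℝ,
        x ∈ Set.Icc (s - 1) (s + 1) → y ∈ Set.Icc (t - 1) (t + 1) →
        Φ (x, y) = Φp s t (x - s) (y - t)) ∧
      ContDiffOn ℝ 1 Φ (Set.Icc (-2 : ℝ) 2 ×ˢ Set.Icc (-2 : ℝ) 2) := by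
  let Φ : ℝ × ℝ → ℝ × ℝ := fun z =>
    ∑ v ∈ ({-2, 0, 2} : Finset ℝ), valueSpline (z.1 - v) •
        ∑ w ∈ ({-2, 0, 2} : Finset ℝ), valueSpline (z.2 - w) • α v w +
      ∑ v ∈ ({-2, 0, 2} : Finset ℝ), slopeSpline (z.1 - v) •
        ∑ w ∈ ({-2, 0, 2} : Finset ℝ), valueSpline (z.2 - w) • β v w +
      ∑ v ∈ ({-2, 0, 2} : Finset ℝ), valueSpline (z.1 - v) •
        ∑ w ∈ ({-2, 0, 2} : Finset ℝ), slopeSpline (z.2 - w) • γ v w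
  have hΦ : ∀ s ∈ ({-1, 1} : Set ℝ), ∀ t ∈ ({-1, 1} : Set ℝ), ∀ x y : ℝ,
      x ∈ Set.Icc (s - 1) (s + 1) → y ∈ Set.Icc (t - 1) (t + 1) →
        Φ (x, y) = Φp s t (x - s) (y - t) := by
    intro s hs t ht x y hx hy
    have hu : x - s ∈ Set.Icc (-1 : ℝ) 1 := ⟨by linarith [hx.1], by linarith [hx.2]⟩
    have hw : y - t ∈ Set.Icc (-1 : ℝ) 1 := ⟨by linarith [hy.1], by linarith [hy.2]⟩
    have hd := hdof s hs t ht
    obtain ⟨a₁, b₁, c₁, -⟩ := hd (-1) (by simp) (-1) (by simp)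
    obtain ⟨a₂, b₂, c₂, -⟩ := hd (-1) (by simp) 1 (by simp)
    obtain ⟨a₃, b₃, c₃, -⟩ := hd 1 (by simp) (-1) (by simp)
    obtain ⟨a₄, b₄, c₄, -⟩ := hd 1 (by simp) 1 (by simp)
    rw [(hbic s hs t ht).eq_hermite (fun x' hx' y' hy' => (hd x' hx' y' hy').2.2.2) hu hw,
      a₁, a₂, a₃, a₄, b₁, b₂, b₃, b₄, c₁, c₂, c₃, c₄]
    have hV : ∀ z, 2 ≤ |z| → valueSpline z = 0 := fun _ => valueSpline_of_two_le_abs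
    have hS : ∀ z, 2 ≤ |z| → slopeSpline z = 0 := fun _ => slopeSpline_of_two_le_abs
    simp only [Φ, sum_knots_smul_eq hV hs hx, sum_knots_smul_eq hS hs hx,
      sum_knots_smul_eq hV ht hy, sum_knots_smul_eq hS ht hy]
  refine ⟨?_, Φ, hΦ, ?_⟩
  · intro s hs t ht s' hs' t' ht' x y hx hy hx' hy'
    rw [← hΦ s hs t ht x y hx hy, hΦ s' hs' t' ht' x y hx' hy']
  · have hV := contDiff_valueSpline
    have hS := contDiff_slopeSpline
    have hΦ' : ContDiff ℝ 1 Φ := by fun_prop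
    exact hΦ'.contDiffOn
end
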